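/- Let G be a 3-edge-coloured multigraph given by a finite edge index set E, an endpoint map assigning to each e ∈ E an unordered pair of vertices, and a colour map c : E → {red, blue, green}; let g be the number of green edges of G. Let H be the 3-edge-coloured graph with vertex set {0,1}, a blue loop and a green loop at 0, a red loop and a green loop at 1, and no other edges. Let G' be the 2-edge-coloured multigraph with edge index set {e ∈ E : c(e) ≠ green} ⊎ ({e ∈ E : c(e) = green} × {red, blue}), where each non-green edge keeps its endpoints and colour, and each green edge e is replaced by two parallel edges with the same endpoints as e, one red and one blue. Then for every natural number k the following are equivalent: (a) there is a set D ⊆ E with |D| ≤ k such that G − D admits a homomorphism to H; (b) there is a set D' of edges of G' with |D'| ≤ k + g such that G' − D' admits a homomorphism to H^{2-}_{r,b}. -/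

import Mathlib

/-- The 3-edge-coloured target graph `H` of Statement 19 on vertex set `{0,1}`
(colours: `0` = red, `1` = blue, `2` = green): a blue loop and a green loop at
`0`, a red loop and a green loop at `1`, and no other edges. -/
def EH19 (i : Fin 3) (u v : Fin 2) : Prop :=
  if i = 0 then u = 1 ∧ v = 1
  else if i = 1 then u = 0 ∧ v = 0
  else (u = 0 ∧ v = 0) ∨ (u = 1 ∧ v = 1)

/-- The edge of `G'` representing `e`: a non-green edge represents itself, and a green edge `e`
is represented by its copy of colour `r e`. -/
def splitEdge {E : Type} {c : E → Fin 3} (r : {e : E // c e = 2} → Bool) (e : E) :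
    {e : E // c e ≠ 2} ⊕ ({e : E // c e = 2} × Bool) :=
  if h : c e = 2 then Sum.inr (⟨e, h⟩, r ⟨e, h⟩) else Sum.inl ⟨e, h⟩

theorem splitEdge_of_green {E : Type} {c : E → Fin 3} (r : {e : E // c e = 2} → Bool)
    (e : {e : E // c e = 2}) : splitEdge r e.1 = Sum.inr (e, r e) := by
  simp [splitEdge, e.2]

theorem splitEdge_of_not_green {E : Type} {c : E → Fin 3} (r : {e : E // c e = 2} → Bool)
    (e : {e : E // c e ≠ 2}) : splitEdge r e.1 = Sum.inl e := by
  simp [splitEdge, e.2]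

theorem splitEdge_injective {E : Type} {c : E → Fin 3} (r : {e : E // c e = 2} → Bool) :
    Function.Injective (splitEdge r) := by
  intro a b hab
  unfold splitEdge at hab
  split_ifs at hab <;> simp_all

theorem card_univ_green {E : Type} [Fintype E] (c : E → Fin 3) :
    (Finset.univ : Finset {e : E // c e = 2}).card =
      (Finset.univ.filter fun e : E => c e = 2).card := by
  rw [Finset.card_univ, Fintype.card_subtype]

/-- Let `G` be a 3-edge-coloured multigraph (edge index type `E`,
endpoints `ends`, colours `c` with `0` = red, `1` = blue, `2` = green), `g` its
number of green edges, and let `G'` be the 2-edge-coloured multigraph obtained by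
replacing each green edge by two parallel edges, one red and one blue (edge index
type `{e // c e ≠ 2} ⊕ ({e // c e = 2} × Bool)`, with `true` = red, `false` =
blue; a non-green edge `e` is red in `G'` iff `c e = 0`).  Then one can delete at
most `k` edges of `G` so that the result maps to `H` iff one can delete at most
`k + g` edges of `G'` so that the result maps to `H^{2-}_{r,b}` (red loop at `0`,
blue loop at `1`). -/
theorem stmt19 (V E : Type) [Fintype V] [Fintype E] [DecidableEq E]
    (ends : E → Sym2 V) (c : E → Fin 3) (k : ℕ) :
    (∃ D : Finset E, D.card ≤ k ∧
        ∃ φ : V → Fin 2, ∀ e : E, e ∉ D →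
          ∀ u v : V, ends e = s(u, v) → EH19 (c e) (φ u) (φ v)) ↔
      (∃ D' : Finset ({e : E // c e ≠ 2} ⊕ ({e : E // c e = 2} × Bool)),
        D'.card ≤ k + (Finset.univ.filter fun e : E => c e = 2).card ∧
        ∃ φ : V → Fin 2,
          (∀ e : {e : E // c e ≠ 2}, Sum.inl e ∉ D' →
            ∀ u v : V, ends e.1 = s(u, v) →
              if c e.1 = 0 then (φ u = 0 ∧ φ v = 0) else (φ u = 1 ∧ φ v = 1)) ∧
          (∀ e : {e : E // c e = 2} × Bool, Sum.inr e ∉ D' →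
            ∀ u v : V, ends e.1.1 = s(u, v) →
              if e.2 then (φ u = 0 ∧ φ v = 0) else (φ u = 1 ∧ φ v = 1))) := by
  classical
  rw [← card_univ_green c]
  constructor
  · rintro ⟨D, hD, φ, hφ⟩
    let r : {e : E // c e = 2} → Bool := fun e => decide (∀ u ∈ ends e.1, φ u = 1)
    refine ⟨D.image (splitEdge r) ∪ Finset.univ.image fun e => Sum.inr (e, !r e),
      (Finset.card_union_le _ _).trans
        (add_le_add (Finset.card_image_le.trans hD) Finset.card_image_le),
      fun v => 1 - φ v, ?_, ?_⟩
    · intro e he u v huv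
      have heD : e.1 ∉ D := fun h => he <| Finset.mem_union_left _ <|
        Finset.mem_image.2 ⟨e.1, h, splitEdge_of_not_green r e⟩
      have hloop := hφ e.1 heD u v huv
      have hc := e.2
      unfold EH19 at hloop
      split_ifs at hloop ⊢ with h0 h1
      · simp [hloop]
      · simp [hloop]
      · omega
    · rintro ⟨e, b⟩ he u v huv
      have hb : b = r e := by
        by_contra hne
        refine he (Finset.mem_union_right _ (Finset.mem_image.2 ⟨e, Finset.mem_univ _, ?_⟩))
        rw [Bool.eq_not_of_ne hne]
      have heD : e.1 ∉ D := fun h => he <| Finset.mem_union_left _ <|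
        Finset.mem_image.2 ⟨e.1, h, by rw [splitEdge_of_green, hb]⟩
      have hloop := hφ e.1 heD u v huv
      simp only [EH19, e.2] at hloop
      have hr : r e = decide (φ u = 1 ∧ φ v = 1) := by simp [r, huv]
      rcases hloop with h | h <;> simp [hb, hr, h]
  · rintro ⟨D', hD', φ, hφ, hφg⟩
    have hdel : ∀ e : {e : E // c e = 2}, ∃ b, Sum.inr (e, b) ∈ D' := by
      intro e
      by_contra! hno
      obtain ⟨⟨u, v⟩, huv⟩ := Sym2.mk_surjective (ends e.1)
      have hred := hφg (e, true) (hno true) u v huv.symm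
      have hblue := hφg (e, false) (hno false) u v huv.symm
      simp_all
    choose s hs using hdel
    let r : {e : E // c e = 2} → Bool := fun e => !s e
    refine ⟨Finset.univ.filter fun e => splitEdge r e ∈ D', ?_, fun v => 1 - φ v, ?_⟩
    · have hdisj : Disjoint ((Finset.univ.filter fun e => splitEdge r e ∈ D').image (splitEdge r))
          (Finset.univ.image fun e => Sum.inr (e, s e)) := by
        rw [Finset.disjoint_left]
        intro x hx hx'
        obtain ⟨e, -, rfl⟩ := Finset.mem_image.1 hx
        obtain ⟨e', -, he'⟩ := Finset.mem_image.1 hx'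
        unfold splitEdge at he'
        split_ifs at he'
        simp only [Sum.inr.injEq, Prod.mk.injEq] at he'
        obtain ⟨rfl, h⟩ := he'
        simp [r] at h
      have hsub : (Finset.univ.filter fun e => splitEdge r e ∈ D').image (splitEdge r) ∪
          (Finset.univ.image fun e => Sum.inr (e, s e)) ⊆ D' := by
        intro x hx
        rcases Finset.mem_union.1 hx with hx | hx
        · obtain ⟨e, he, rfl⟩ := Finset.mem_image.1 hx
          exact (Finset.mem_filter.1 he).2
        · obtain ⟨e, -, rfl⟩ := Finset.mem_image.1 hx
          exact hs e
      have hcard := (Finset.card_le_card hsub).trans hD'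
      rw [Finset.card_union_of_disjoint hdisj,
        Finset.card_image_of_injective _ (splitEdge_injective r),
        Finset.card_image_of_injective _ fun a b hab => (Prod.mk.inj (Sum.inr.inj hab)).1] at hcard
      exact Nat.le_of_add_le_add_right hcard
    · intro e he u v huv
      replace he : splitEdge r e ∉ D' := fun h => he (by simpa using h)
      by_cases hc : c e = 2
      · rw [splitEdge_of_green r ⟨e, hc⟩] at he
        have hloop := hφg _ he u v huv
        simp only [EH19, hc]
        split_ifs at hloop <;> simp [hloop]
      · rw [splitEdge_of_not_green r ⟨e, hc⟩] at he
        have hloop := hφ _ he u v huv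
        unfold EH19
        split_ifs at hloop ⊢ with h0 h1
        · simp [hloop]
        · simp [hloop]
        · omega
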